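/- Let n ≥ 4, let φ : A* → DPS_n be the monoid homomorphism from the free monoid on A = {a₁,a₂,b₁,b₂,c} extending a₁ ↦ α₁, a₂ ↦ α₂, b₁ ↦ β₁, b₂ ↦ β₂, c ↦ γ, and let ρ_R be the smallest congruence on A* containing the relation set R. Then for all words w₁, w₂ over the subalphabet {a₁,a₂,b₁,b₂} (containing no occurrence of c), if φ(w₁) = φ(w₂) then w₁ = w₂ is a consequence of R, i.e., (w₁,w₂) ∈ ρ_R. -/

import Mathlib

namespace DPSPaper

instance instMonoidPFun {V : Type*} : Monoid (V →. V) where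
  mul f g := g.comp f
  one := PFun.id V
  mul_assoc a b c := (PFun.comp_assoc c b a).symm
  one_mul := PFun.comp_id
  mul_one := PFun.id_comp

/-- The geodesic distance in the star graph `S_n` on vertices `{0,1,...,n-1}`. -/
def starDist (n : ℕ) (x y : Fin n) : ℕ :=
  if x = y then 0 else if (x : ℕ) = 0 ∨ (y : ℕ) = 0 then 1 else 2

/-- Injectivity of a partial map. -/
def PInj {n : ℕ} (α : Fin n →. Fin n) : Prop :=
  ∀ ⦃x y a : Fin n⦄, a ∈ α x → a ∈ α y → x = y

/-- `α` is a partial isometry of the star graph `S_n`. -/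
def IsStarPI {n : ℕ} (α : Fin n →. Fin n) : Prop :=
  PInj α ∧ ∀ ⦃x y u v : Fin n⦄, u ∈ α x → v ∈ α y → starDist n u v = starDist n x y

/-- The set of all partial isometries of `S_n`. -/
def DPSset (n : ℕ) : Set (Fin n →. Fin n) := { α | IsStarPI α }

/-- `α₁` : fixes 0, sends `i ↦ i+1` for `1 ≤ i ≤ n-2`, and `n-1 ↦ 1`. -/
def alphaOne (n : ℕ) (hn : 3 ≤ n) : Fin n →. Fin n :=
  fun x => Part.some <|
    if (x : ℕ) = 0 then x
    else if h : (x : ℕ) = n - 1 then ⟨1, by omega⟩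
    else ⟨(x : ℕ) + 1, by have := x.isLt; omega⟩

/-- `α₂` : fixes 0 and every `i ≥ 3`, swaps 1 and 2. -/
def alphaTwo (n : ℕ) (hn : 3 ≤ n) : Fin n →. Fin n :=
  fun x => Part.some <|
    if (x : ℕ) = 1 then ⟨2, by omega⟩
    else if (x : ℕ) = 2 then ⟨1, by omega⟩
    else x

/-- `β₁` : the partial identity on `{0,1,...,n-2}`. -/
def betaOne (n : ℕ) : Fin n →. Fin n :=
  fun x => if (x : ℕ) ≤ n - 2 then Part.some x else Part.none

/-- `β₂` : the partial identity on `{1,...,n-1}`. -/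
def betaTwo (n : ℕ) : Fin n →. Fin n :=
  fun x => if (x : ℕ) = 0 then Part.none else Part.some x

/-- `γ` : domain `{0,1}`, sending `0 ↦ 1` and `1 ↦ 0`. -/
def gammaMap (n : ℕ) (hn : 3 ≤ n) : Fin n →. Fin n :=
  fun x =>
    if (x : ℕ) = 0 then Part.some ⟨1, by omega⟩
    else if (x : ℕ) = 1 then Part.some ⟨0, by omega⟩
    else Part.none

/-- The five-letter alphabet `A = {a₁, a₂, b₁, b₂, c}`. -/
inductive Gen : Type
  | a1 | a2 | b1 | b2 | c
deriving DecidableEq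

abbrev W := FreeMonoid Gen

def wa1 : W := FreeMonoid.of Gen.a1
def wa2 : W := FreeMonoid.of Gen.a2
def wb1 : W := FreeMonoid.of Gen.b1
def wb2 : W := FreeMonoid.of Gen.b2
def wc  : W := FreeMonoid.of Gen.c

/-- The set `R` of `3n+9` defining relations over the alphabet `A`. -/
def Rrel (n : ℕ) : W → W → Prop := fun u v =>
  (u = wa2 ^ 2 ∧ v = 1) ∨
  (u = wa1 ^ (n - 1) ∧ v = 1) ∨
  (u = (wa1 * wa2) ^ (n - 2) ∧ v = 1) ∨
  (u = (wa2 * wa1 ^ (n - 2) * wa2 * wa1) ^ 3 ∧ v = 1) ∨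
  (∃ j, 2 ≤ j ∧ j ≤ n - 3 ∧ u = (wa2 * wa1 ^ (n - 1 - j) * wa2 * wa1 ^ j) ^ 2 ∧ v = 1) ∨
  (u = wb1 ^ 2 ∧ v = wb1) ∨
  (u = wb2 ^ 2 ∧ v = wb2) ∨
  (u = wa2 * wb1 ∧ v = wb1 * wa2) ∨
  (u = wb2 * wa2 ∧ v = wa2 * wb2) ∨
  (u = wb2 * wa1 ∧ v = wa1 * wb2) ∨
  (u = wb2 * wb1 ∧ v = wb1 * wb2) ∨
  (u = wa1 * wa2 * wa1 ^ (n - 2) * wb1 * wa1 * wa2 * wa1 ^ (n - 2) ∧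
    v = wa1 ^ (n - 2) * wb1 * wa1) ∨
  (u = (wa1 ^ (n - 2) * wb1 * wa1 * wa2) ^ 2 ∧ v = (wa2 * wa1 ^ (n - 2) * wb1 * wa1) ^ 2) ∨
  (u = wa1 ^ (n - 2) * wb1 * wa1 * wa2 * wa1 ^ (n - 2) * wb1 * wa1 ∧
    v = (wa2 * wa1 ^ (n - 2) * wb1 * wa1) ^ 2) ∨
  (u = wc ^ 3 ∧ v = wc) ∨
  (u = wc * wa1 ∧ v = wc * wa2) ∨
  (u = wa1 ^ (n - 2) * wc ∧ v = wa2 * wc) ∨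
  (∃ j, 1 ≤ j ∧ j ≤ n - 3 ∧ u = wa2 * wa1 ^ j * wc ∧ v = wa1 ^ j * wc) ∨
  (u = wb1 * wa1 * wc ∧ v = wc * wb2) ∨
  (∃ j, 2 ≤ j ∧ j ≤ n - 3 ∧ u = wb1 * wa1 ^ j * wc ∧ v = wa1 ^ j * wc) ∨
  (u = (wb1 * wa1) ^ (n - 3) * wb1 ∧ v = wc ^ 2 * wa2 * wa1 ^ (n - 4)) ∨
  (u = wb2 * wc ^ 2 ∧ v = wc * wa2 * wc) ∨
  (u = (wb2 * wc) ^ 2 ∧ v = wb2 * wc * wb2)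

/-- The images of the generators. -/
def genMap (n : ℕ) (hn : 3 ≤ n) : Gen → (Fin n →. Fin n)
  | Gen.a1 => alphaOne n hn
  | Gen.a2 => alphaTwo n hn
  | Gen.b1 => betaOne n
  | Gen.b2 => betaTwo n
  | Gen.c  => gammaMap n hn

/-- The homomorphism `φ : A* → DPS_n` extending `a₁ ↦ α₁, a₂ ↦ α₂, b₁ ↦ β₁, b₂ ↦ β₂, c ↦ γ`. -/
def phi (n : ℕ) (hn : 3 ≤ n) : W →* (Fin n →. Fin n) :=
  FreeMonoid.lift (genMap n hn)

/-- The number of occurrences of the letter `x` in the word `w`. -/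
def cnt (x : Gen) (w : W) : ℕ := (FreeMonoid.toList w).count x

/-! ### Coxeter presentation of the symmetric group -/

/-- `S 0 * S 1 * ... * S (j-1)` -/
def chain {G : Type*} [Monoid G] (S : ℕ → G) : ℕ → G
  | 0 => 1
  | j + 1 => chain S j * S j

theorem chain_comm_high {G : Type*} [Group G] (k : ℕ) (S : ℕ → G)
    (hc : ∀ i j, i + 1 < j → j < k → S i * S j = S j * S i) (i : ℕ) (hi : i < k) :
    ∀ j, j < i → chain S j * S i = S i * chain S j := by
  intro j
  induction j with
  | zero => intro _; simp [chain]
  | succ j ih =>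
    intro hj
    have h1 := ih (by omega)
    have h2 := hc j i hj hi
    simp only [chain]
    rw [mul_assoc, h2, ← mul_assoc, h1, mul_assoc]

theorem chain_comm_low {G : Type*} [Group G] (k : ℕ) (S : ℕ → G)
    (hb : ∀ i, i + 1 < k → S i * S (i + 1) * S i = S (i + 1) * S i * S (i + 1))
    (hc : ∀ i j, i + 1 < j → j < k → S i * S j = S j * S i) (i : ℕ) :
    ∀ j, i + 1 < j → j ≤ k → chain S j * S i = S (i + 1) * chain S j := by
  intro j hj
  induction j, hj using Nat.le_induction with
  | base =>
    intro hk
    have h1 := chain_comm_high k S hc (i + 1) (by omega) i (by omega)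
    have h2 := hb i (by omega)
    show chain S i * S i * S (i + 1) * S i = S (i + 1) * (chain S i * S i * S (i + 1))
    calc chain S i * S i * S (i + 1) * S i = chain S i * (S i * S (i + 1) * S i) := by
          simp only [mul_assoc]
      _ = chain S i * S (i + 1) * S i * S (i + 1) := by rw [h2]; simp only [mul_assoc]
      _ = _ := by rw [h1]; simp only [mul_assoc]
  | succ j hj ih =>
    intro hk
    have h1 := ih (by omega)
    have h2 := hc i j hj (by omega)
    simp only [chain]
    rw [mul_assoc, ← h2, ← mul_assoc, h1, mul_assoc]

open Equiv in
theorem coxeter_inj {G X : Type*} [Group G] [DecidableEq X] (f : G →* Perm X) :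
    ∀ (k : ℕ) (S : ℕ → G) (x : ℕ → X)
    (_ : ∀ i j, i ≤ k → j ≤ k → x i = x j → i = j)
    (_ : ∀ i, i < k → f (S i) = swap (x i) (x (i + 1)))
    (_ : ∀ i, i < k → S i * S i = 1)
    (_ : ∀ i, i + 1 < k → S i * S (i + 1) * S i = S (i + 1) * S i * S (i + 1))
    (_ : ∀ i j, i + 1 < j → j < k → S i * S j = S j * S i),
    ∀ g ∈ Subgroup.closure {g | ∃ i, i < k ∧ g = S i}, f g = 1 → g = 1 := by
  intro k
  induction k with
  | zero =>
    intro S x _ _ _ _ _ g hg _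
    have : {g | ∃ i, i < 0 ∧ g = S i} = ∅ := by ext; simp
    rw [this, Subgroup.closure_empty] at hg
    exact hg
  | succ k ih =>
    intro S x hx hf h2 hb hc g hg hfg
    set H := Subgroup.closure {g | ∃ i, i < k ∧ g = S (i + 1)} with hH
    have memH : ∀ i, i < k → S (i + 1) ∈ H := fun i hi => Subgroup.subset_closure ⟨i, hi, rfl⟩
    have key : ∃ h ∈ H, ∃ j, j ≤ k + 1 ∧ g = h * chain S j := by
      have step : ∀ g, (∃ h ∈ H, ∃ j, j ≤ k + 1 ∧ g = h * chain S j) → ∀ i, i < k + 1 →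
          (∃ h ∈ H, ∃ j, j ≤ k + 1 ∧ g * S i = h * chain S j) := by
        rintro g ⟨h, hh, j, hj, rfl⟩ i hi
        rcases lt_trichotomy i j with hij | hij | hij
        · rcases Nat.lt_or_ge (i + 1) j with h' | h'
          · refine ⟨h * S (i + 1), H.mul_mem hh (memH i (by omega)), j, hj, ?_⟩
            rw [mul_assoc, chain_comm_low (k + 1) S hb hc i j h' hj, mul_assoc]
          · obtain rfl : j = i + 1 := by omega
            refine ⟨h, hh, i, by omega, ?_⟩
            simp only [chain]
            rw [mul_assoc, mul_assoc, h2 i hi, mul_one]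
        · subst hij
          exact ⟨h, hh, i + 1, by omega, by simp [chain, mul_assoc]⟩
        · obtain ⟨i, rfl⟩ : ∃ i', i = i' + 1 := ⟨i - 1, by omega⟩
          refine ⟨h * S (i + 1), H.mul_mem hh (memH i (by omega)), j, hj, ?_⟩
          rw [mul_assoc, chain_comm_high (k + 1) S hc (i + 1) hi j hij, mul_assoc]
      clear hfg
      induction hg using Subgroup.closure_induction_right with
      | one => exact ⟨1, H.one_mem, 0, by omega, by simp [chain]⟩
      | mul_right y hy z hz ih' =>
        obtain ⟨i, hi, rfl⟩ := hz
        exact step _ ih' i hi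
      | mul_inv_cancel y hy z hz ih' =>
        obtain ⟨i, hi, rfl⟩ := hz
        have : (S i)⁻¹ = S i := inv_eq_of_mul_eq_one_left (h2 i hi)
        rw [this]
        exact step _ ih' i hi
    obtain ⟨h, hh, j, hj, rfl⟩ := key
    have fixH : ∀ h ∈ H, f h (x 0) = x 0 := by
      intro h hh
      have : H ≤ (MulAction.stabilizer (Perm X) (x 0)).comap f := by
        rw [hH, Subgroup.closure_le]
        rintro _ ⟨i, hi, rfl⟩
        simp only [Subgroup.coe_comap, Set.mem_preimage, SetLike.mem_coe,
          MulAction.mem_stabilizer_iff, Perm.smul_def]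
        rw [hf _ (by omega), swap_apply_of_ne_of_ne]
        · intro h; have := hx _ _ (by omega) (by omega) h; omega
        · intro h; have := hx _ _ (by omega) (by omega) h; omega
      exact this hh
    have fD : ∀ j, j ≤ k + 1 → f (chain S j) (x j) = x 0 := by
      intro j
      induction j with
      | zero => intro _; simp [chain]
      | succ j ihj =>
        intro hj
        simp only [chain, map_mul, Perm.mul_apply]
        rw [hf _ (by omega), swap_apply_right, ihj (by omega)]
    have h0 : x 0 = x j := by
      have := congrArg (fun p : Perm X => p (x j)) hfg
      simp only [map_mul, Perm.mul_apply, fD j hj, fixH h hh, Perm.one_apply] at this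
      exact this
    obtain rfl : j = 0 := (hx _ _ (by omega) hj h0).symm
    simp only [chain, mul_one] at hfg ⊢
    refine ih (fun i => S (i + 1)) (fun i => x (i + 1)) ?_ ?_ ?_ ?_ ?_ h hh hfg
    · intro i j hi hj h
      have := hx _ _ (by omega) (by omega) h
      omega
    · intro i hi; exact hf _ (by omega)
    · intro i hi; exact h2 _ (by omega)
    · intro i hi; exact hb _ (by omega)
    · intro i j hi hj; exact hc _ _ (by omega) (by omega)

open Equiv in
/-- Moore's presentation of the symmetric group. -/
theorem moore_hom {G : Type*} [Group G] (k : ℕ) (a t : G)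
    (ht : t * t = 1) (ha : a ^ (k + 3) = 1) (hat : (a * t) ^ (k + 2) = 1)
    (h3 : (t * a⁻¹ * t * a) ^ 3 = 1)
    (hj : ∀ j, 2 ≤ j → j ≤ k + 1 → (t * (a ^ j)⁻¹ * t * a ^ j) ^ 2 = 1) :
    ∃ ψ : Perm (Fin (k + 3)) →* G, ψ (finRotate (k + 3))⁻¹ = a ∧ ψ (swap 0 1) = t := by
  let pt : ℕ → Fin (k + 3) := fun i => Fin.ofNat (k + 3) i
  let v : ℕ → G := fun i => (a ^ i)⁻¹ * t * a ^ i
  have tinv : t⁻¹ = t := inv_eq_of_mul_eq_one_left ht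
  let S : ℕ → G × Perm (Fin (k + 3)) := fun i => (v i, swap (pt i) (pt (i + 1)))
  have hpt : ∀ i j, i ≤ k + 2 → j ≤ k + 2 → pt i = pt j → i = j := by
    intro i j hi hj h
    have := congrArg Fin.val h
    simp only [pt, Fin.val_ofNat] at this
    rwa [Nat.mod_eq_of_lt (by omega), Nat.mod_eq_of_lt (by omega)] at this
  have hv2 : ∀ i, v i * v i = 1 := by
    intro i
    simp only [v]
    calc _ = (a ^ i)⁻¹ * (t * t) * a ^ i := by group
      _ = 1 := by rw [ht]; group
  have hvb : ∀ i, v i * v (i + 1) * v i = v (i + 1) * v i * v (i + 1) := by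
    intro i
    have e1 : t * (a⁻¹ * t * a) * t = (a⁻¹ * t * a) * t * (a⁻¹ * t * a) := by
      have e : (t * (a⁻¹ * t * a)* t) * ((a⁻¹ * t * a) * t * (a⁻¹ * t * a)) = 1 := by
        rw [← h3]; simp only [pow_succ, pow_zero, one_mul, mul_assoc]
      rw [mul_eq_one_iff_eq_inv] at e
      rw [e]
      simp only [mul_inv_rev, tinv, inv_inv, mul_assoc]
    have e2 : v (i + 1) = (a ^ i)⁻¹ * (a⁻¹ * t * a) * a ^ i := by
      simp only [v]; rw [pow_succ']; group
    have e3 : v i = (a ^ i)⁻¹ * t * a ^ i := rfl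
    rw [e2, e3]
    generalize a⁻¹ * t * a = w at *
    calc _ = (a ^ i)⁻¹ * (t * w * t) * a ^ i := by group
      _ = _ := by rw [e1]; group
  have hvc : ∀ i j, i + 1 < j → j < k + 2 → v i * v j = v j * v i := by
    intro i j hij hjk
    obtain ⟨d, rfl⟩ : ∃ d, j = d + i := ⟨j - i, by omega⟩
    have e1 : t * ((a ^ d)⁻¹ * t * a ^ d) = ((a ^ d)⁻¹ * t * a ^ d) * t := by
      have e := hj d (by omega) (by omega)
      have e : (t * ((a ^ d)⁻¹ * t * a ^ d)) * (t * ((a ^ d)⁻¹ * t * a ^ d)) = 1 := by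
        rw [← e]; simp only [pow_succ, pow_zero, one_mul, mul_assoc]
      rw [mul_eq_one_iff_eq_inv] at e
      rw [e]
      simp only [mul_inv_rev, tinv, inv_inv, mul_assoc]
    have e2 : v (d + i) = (a ^ i)⁻¹ * ((a ^ d)⁻¹ * t * a ^ d) * a ^ i := by
      simp only [v]; rw [pow_add]; group
    have e3 : v i = (a ^ i)⁻¹ * t * a ^ i := rfl
    rw [e2, e3]
    generalize (a ^ d)⁻¹ * t * a ^ d = w at *
    calc _ = (a ^ i)⁻¹ * (t * w) * a ^ i := by group
      _ = _ := by rw [e1]; group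
  have hne : ∀ i j, i ≤ k + 2 → j ≤ k + 2 → i ≠ j → pt i ≠ pt j := fun i j hi hj h h' =>
    h (hpt i j hi hj h')
  let K := Subgroup.closure {g | ∃ i, i < k + 2 ∧ g = S i}
  have hS : ∀ i, i < k + 2 → S i ∈ K := fun i hi => Subgroup.subset_closure ⟨i, hi, rfl⟩
  have inj : ∀ g ∈ K, g.2 = 1 → g = 1 := by
    refine coxeter_inj (MonoidHom.snd G (Perm (Fin (k + 3)))) (k + 2) S pt hpt ?_ ?_ ?_ ?_
    · intro i hi; rfl
    · intro i hi; simp only [S, Prod.mk_mul_mk, hv2, swap_mul_self]; rfl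
    · intro i hi
      simp only [S, Prod.mk_mul_mk, hvb]
      refine Prod.ext rfl ?_
      have n1 := hne i (i + 1) (by omega) (by omega) (by omega)
      have n2 := hne i (i + 2) (by omega) (by omega) (by omega)
      have n3 := hne (i + 1) (i + 2) (by omega) (by omega) (by omega)
      show swap (pt i) (pt (i + 1)) * swap (pt (i + 1)) (pt (i + 2)) * swap (pt i) (pt (i + 1)) =
        swap (pt (i + 1)) (pt (i + 2)) * swap (pt i) (pt (i + 1)) * swap (pt (i + 1)) (pt (i + 2))
      generalize pt i = p at *
      generalize pt (i + 1) = q at *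
      generalize pt (i + 2) = r at *
      have l1 := swap_mul_swap_mul_swap n3.symm n2.symm
      have l2 := swap_mul_swap_mul_swap n1 n2
      rw [l2, swap_comm p q, swap_comm q r, l1, swap_comm]
    · intro i j hij hjk
      simp only [S, Prod.mk_mul_mk, hvc i j hij hjk]
      refine Prod.ext rfl ?_
      refine Perm.Disjoint.commute ?_
      refine Equiv.Perm.disjoint_iff_disjoint_support.2 ?_
      rw [Perm.support_swap (hne _ _ (by omega) (by omega) (by omega)),
        Perm.support_swap (hne _ _ (by omega) (by omega) (by omega))]
      have n1 := hne i j (by omega) (by omega) (by omega)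
      have n2 := hne i (j + 1) (by omega) (by omega) (by omega)
      have n3 := hne (i + 1) j (by omega) (by omega) (by omega)
      have n4 := hne (i + 1) (j + 1) (by omega) (by omega) (by omega)
      simp [n1.symm, n2.symm, n3.symm, n4.symm]
  have surj : ∀ p : Perm (Fin (k + 3)), ∃ q, (q, p) ∈ K := by
    have : (⊤ : Submonoid (Perm (Fin (k + 3)))) ≤ 
        (K.map (MonoidHom.snd G (Perm (Fin (k + 3))))).toSubmonoid := by
      rw [← Equiv.Perm.mclosure_swap_castSucc_succ, Submonoid.closure_le]
      rintro _ ⟨i, rfl⟩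
      refine ⟨S i, hS _ i.isLt, ?_⟩
      show swap _ _ = swap _ _
      congr 1
      · ext
        simp only [pt, Fin.val_ofNat, Fin.val_castSucc]; exact Nat.mod_eq_of_lt (by omega)
      · ext
        simp only [pt, Fin.val_ofNat, Fin.val_succ]; exact Nat.mod_eq_of_lt (by omega)
    intro p
    obtain ⟨⟨q, p'⟩, h, rfl⟩ := this (Submonoid.mem_top p)
    exact ⟨q, h⟩
  choose ψ hψ using surj
  have uniq : ∀ q p, (q, p) ∈ K → ψ p = q := by
    intro q p h
    have := inj _ (K.mul_mem (hψ p) (K.inv_mem h)) (by simp)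
    have := congrArg Prod.fst this
    simp only [Prod.fst_mul, Prod.fst_inv, Prod.fst_one] at this
    exact mul_inv_eq_one.1 this
  refine ⟨MonoidHom.mk' ψ ?_, ?_, ?_⟩
  · intro p p'
    exact uniq _ _ (K.mul_mem (hψ p) (hψ p'))
  · refine uniq _ _ ?_
    have main : ∀ j, j ≤ k + 2 → ∃ p : Perm (Fin (k + 3)), ((a ^ j)⁻¹ * (a * t) ^ j, p) ∈ K ∧
        ∀ x : Fin (k + 3), (p x : ℕ) = if (x : ℕ) = 0 then j else if (x : ℕ) ≤ j then x - 1 else x := by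
      intro j
      induction j with
      | zero =>
        intro _
        refine ⟨1, by simp only [pow_zero, inv_one, mul_one]; exact K.one_mem, ?_⟩
        intro x
        simp only [Perm.one_apply]
        split_ifs <;> omega
      | succ j ih =>
        intro hj
        obtain ⟨p, hp, hpx⟩ := ih (by omega)
        refine ⟨swap (pt j) (pt (j + 1)) * p, ?_, ?_⟩
        · have := K.mul_mem (hS j (by omega)) hp
          simp only [S, Prod.mk_mul_mk, v] at this
          convert this using 2
          rw [pow_succ' (a * t), pow_succ' a]
          simp only [mul_inv_rev, mul_assoc, inv_mul_cancel_left, mul_inv_cancel_left]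
        · intro x
          have hx := hpx x
          have e0 : (pt j : ℕ) = j := by simp only [pt, Fin.val_ofNat]; exact Nat.mod_eq_of_lt (by omega)
          have e1 : (pt (j + 1) : ℕ) = j + 1 := by
            simp only [pt, Fin.val_ofNat]; exact Nat.mod_eq_of_lt (by omega)
          simp only [Perm.mul_apply, swap_apply_def, Fin.ext_iff, e0, e1, hx, apply_ite Fin.val]
          split_ifs <;> omega
    obtain ⟨p, hp, hpx⟩ := main (k + 2) le_rfl
    have e : p = (finRotate (k + 3))⁻¹ := by
      rw [eq_inv_iff_mul_eq_one]
      ext x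
      have := hpx (finRotate (k + 3) x)
      have h2 := coe_finRotate (n := k + 2) x
      have h3 := x.isLt
      simp only [Perm.mul_apply, this, Perm.one_apply]
      rw [h2]
      by_cases h4 : x = Fin.last _
      · have h5 : (x : ℕ) = k + 2 := by rw [h4]; rfl
        simp only [if_pos h4]
        rw [if_pos trivial, h5]
      · have h5 : (x : ℕ) ≠ k + 2 := fun h => h4 (Fin.ext h)
        simp only [if_neg h4]
        rw [if_neg (by omega), if_pos (by omega)]
        omega
    rw [← e]
    convert hp using 2
    rw [hat, mul_one]
    refine eq_inv_of_mul_eq_one_left ?_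
    rw [← pow_succ', ha]
  · refine uniq _ _ ?_
    have := hS 0 (by omega)
    convert this using 2
    · simp [v]
    · rfl

open Equiv in
theorem perm_mem_of_swaps {X : Type*} [DecidableEq X] (T : Submonoid (Perm X)) (A : Finset X) :
    (∀ i ∈ A, ∀ j ∈ A, swap i j ∈ T) → ∀ h : Perm X, (∀ y, y ∉ A → h y = y) → h ∈ T := by
  induction A using Finset.induction_on with
  | empty =>
    intro _ h hh
    have : h = 1 := by ext y; exact hh y (by simp)
    rw [this]; exact T.one_mem
  | insert c A hc ih =>
    intro hT h hh
    have ih' := ih fun i hi j hj => hT i (by simp [hi]) j (by simp [hj])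
    have hmem : h c ∈ insert c A := by
      by_contra hcon
      have := h.injective (hh _ hcon)
      rw [this] at hcon
      simp at hcon
    have e : h = swap c (h c) * (swap c (h c) * h) := by
      rw [← mul_assoc, swap_mul_self, one_mul]
    rw [e]
    refine T.mul_mem (hT _ (by simp) _ hmem) (ih' _ ?_)
    intro y hy
    simp only [Perm.mul_apply]
    by_cases hyc : y = c
    · subst hyc; simp
    · have : y ∉ insert c A := by simp [hyc, hy]
      rw [hh y this]
      refine swap_apply_of_ne_of_ne hyc ?_
      rintro rfl
      exact this hmem

/-! ### Popova's relations for the symmetric inverse monoid -/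

open Equiv in
/-- Relations satisfied by the idempotent `b` relative to the symmetric group. -/
structure Popova {Q : Type*} [Monoid Q] (k : ℕ) (ψ : Perm (Fin (k + 3)) →* Q) (b : Q) : Prop where
  bb : b * b = b
  tb : ψ (swap 0 1) * b = b * ψ (swap 0 1)
  sb : ψ (finRotate (k + 3))⁻¹ * ψ (swap 0 1) * ψ (finRotate (k + 3)) * b *
      ψ (finRotate (k + 3))⁻¹ * ψ (swap 0 1) * ψ (finRotate (k + 3)) =
      ψ (finRotate (k + 3)) * b * ψ (finRotate (k + 3))⁻¹
  comm : (ψ (finRotate (k + 3)) * b * ψ (finRotate (k + 3))⁻¹ * ψ (swap 0 1)) ^ 2 =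
      (ψ (swap 0 1) * (ψ (finRotate (k + 3)) * b * ψ (finRotate (k + 3))⁻¹)) ^ 2
  absorb : ψ (finRotate (k + 3)) * b * ψ (finRotate (k + 3))⁻¹ * ψ (swap 0 1) *
      (ψ (finRotate (k + 3)) * b * ψ (finRotate (k + 3))⁻¹) =
      (ψ (swap 0 1) * (ψ (finRotate (k + 3)) * b * ψ (finRotate (k + 3))⁻¹)) ^ 2

theorem rot_ofNat (k i : ℕ) (hi : i < k + 2) :
    finRotate (k + 3) (Fin.ofNat (k + 3) i) = Fin.ofNat (k + 3) (i + 1) := by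
  have h1 : ((Fin.ofNat (k + 3) i : Fin (k + 3)) : ℕ) = i := by
    rw [Fin.val_ofNat]; exact Nat.mod_eq_of_lt (by omega)
  have h2 : ((Fin.ofNat (k + 3) (i + 1) : Fin (k + 3)) : ℕ) = i + 1 := by
    rw [Fin.val_ofNat]; exact Nat.mod_eq_of_lt (by omega)
  have h3 := coe_finRotate_of_ne_last (n := k + 2) (i := Fin.ofNat (k + 3) i) (by
    intro h
    have := congrArg Fin.val h
    rw [h1, Fin.val_last] at this
    omega)
  ext
  rw [h2, ← h1, ← h3, h1]

theorem ofNat_ne (k i j : ℕ) (hi : i < k + 3) (hj : j < k + 3) (h : i ≠ j) :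
    Fin.ofNat (k + 3) i ≠ Fin.ofNat (k + 3) j := by
  intro h'
  have := congrArg Fin.val h'
  rw [Fin.val_ofNat, Fin.val_ofNat, Nat.mod_eq_of_lt hi, Nat.mod_eq_of_lt hj] at this
  exact h this

open Equiv in
/-- The perms whose image commutes with `b`. -/
def commSub {Q X : Type*} [Monoid Q] (ψ : Perm X →* Q) (b : Q) : Subgroup (Perm X) where
  carrier := {p | ψ p * b = b * ψ p}
  one_mem' := by simp
  mul_mem' := by
    intro p q hp hq
    simp only [Set.mem_ofPred_eq, map_mul] at *
    rw [mul_assoc, hq, ← mul_assoc, hp, mul_assoc]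
  inv_mem' := by
    intro p hp
    simp only [Set.mem_ofPred_eq] at *
    have h1 : ψ p⁻¹ * ψ p = 1 := by rw [← map_mul]; simp
    have h2 : ψ p * ψ p⁻¹ = 1 := by rw [← map_mul]; simp
    calc ψ p⁻¹ * b = ψ p⁻¹ * (b * ψ p) * ψ p⁻¹ := by rw [mul_assoc, mul_assoc, h2, mul_one]
      _ = _ := by rw [← hp, ← mul_assoc, h1, one_mul]

open Equiv in
theorem Popova.stab {Q : Type*} [Monoid Q] {k : ℕ} {ψ : Perm (Fin (k + 3)) →* Q} {b : Q}
    (P : Popova k ψ b) (h : Perm (Fin (k + 3))) (hh : h (Fin.last (k + 2)) = Fin.last (k + 2)) :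
    ψ h * b = b * ψ h := by
  let pt : ℕ → Fin (k + 3) := fun i => Fin.ofNat (k + 3) i
  have hne : ∀ i j, i < k + 3 → j < k + 3 → i ≠ j → pt i ≠ pt j := ofNat_ne k
  have p0 : pt 0 = 0 := rfl
  have p1 : pt 1 = 1 := rfl
  set ρ := finRotate (k + 3) with hρ
  have hr : ∀ i, i < k + 2 → ρ (pt i) = pt (i + 1) := rot_ofNat k
  have hri : ∀ i, i < k + 2 → ρ⁻¹ (pt (i + 1)) = pt i := by
    intro i hi
    rw [Perm.inv_eq_iff_eq, hr i hi]
  let T := commSub ψ b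
  let s := ρ⁻¹ * swap 0 1 * ρ
  let c := ρ⁻¹ * s
  have ss : s * s = 1 := by
    simp only [s]
    calc _ = ρ⁻¹ * (swap 0 1 * swap 0 1) * ρ := by group
      _ = 1 := by rw [swap_mul_self]; group
  have hc : c ∈ T := by
    show ψ c * b = b * ψ c
    have h1 := P.sb
    rw [← hρ] at h1
    have h1 : ψ s * b * ψ s = ψ ρ * b * ψ ρ⁻¹ := by
      simp only [s, map_mul]; rw [← h1]; simp only [mul_assoc]
    have h2 : ψ ρ⁻¹ * ψ ρ = 1 := by rw [← map_mul]; simp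
    have h3 : ψ s * ψ s = 1 := by rw [← map_mul, ss, map_one]
    simp only [c, map_mul]
    calc ψ ρ⁻¹ * ψ s * b = ψ ρ⁻¹ * (ψ s * b * ψ s) * ψ s := by
          simp only [mul_assoc, h3, mul_one]
      _ = (ψ ρ⁻¹ * ψ ρ) * b * ψ ρ⁻¹ * ψ s := by rw [h1]; simp only [mul_assoc]
      _ = _ := by rw [h2, one_mul, mul_assoc]
  have hcx : ∀ i, i + 1 < k + 2 → c (pt (i + 1)) = pt i := by
    intro i hi
    simp only [c, s, Perm.mul_apply]
    rw [hr _ hi, swap_apply_of_ne_of_ne, hri _ hi, hri _ (by omega)]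
    · rw [← p0]; exact hne _ _ (by omega) (by omega) (by omega)
    · rw [← p1]; exact hne _ _ (by omega) (by omega) (by omega)
  have adj : ∀ i, i + 1 < k + 2 → swap (pt i) (pt (i + 1)) ∈ T := by
    intro i
    induction i with
    | zero => intro _; exact P.tb
    | succ i ih =>
      intro hi
      have h1 := Equiv.mul_swap_eq_swap_mul c (pt (i + 1)) (pt (i + 2))
      rw [hcx _ (by omega), hcx _ (by omega)] at h1
      have h2 : swap (pt (i + 1)) (pt (i + 2)) = c⁻¹ * (swap (pt i) (pt (i + 1)) * c) := by
        rw [← h1, inv_mul_cancel_left]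
      rw [h2]
      exact T.mul_mem (T.inv_mem hc) (T.mul_mem (ih (by omega)) hc)
  have lt : ∀ i j, i < j → j < k + 2 → swap (pt i) (pt j) ∈ T := by
    intro i j hij
    induction j, hij using Nat.le_induction with
    | base => intro hj; exact adj i hj
    | succ j hij ih =>
      intro hj
      have h0 := adj j hj
      have h1 := Equiv.mul_swap_eq_swap_mul (swap (pt j) (pt (j + 1))) (pt i) (pt j)
      rw [swap_apply_left, swap_apply_of_ne_of_ne (hne _ _ (by omega) (by omega) (by omega))
        (hne _ _ (by omega) (by omega) (by omega))] at h1
      have h2 := T.mul_mem (T.mul_mem h0 (ih (by omega))) h0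
      rwa [h1, mul_assoc, swap_mul_self, mul_one] at h2
  refine perm_mem_of_swaps T.toSubmonoid (Finset.univ.erase (Fin.last (k + 2))) ?_ h ?_
  · have hpt : ∀ i ∈ Finset.univ.erase (Fin.last (k + 2)), pt i = i ∧ (i : ℕ) < k + 2 := by
      intro i hi
      refine ⟨Fin.ofNat_val_eq_self i, ?_⟩
      have : (i : ℕ) ≠ k + 2 := fun h => (Finset.ne_of_mem_erase hi) (Fin.ext h)
      omega
    intro i hi j hj
    obtain ⟨hi1, hi2⟩ := hpt i hi
    obtain ⟨hj1, hj2⟩ := hpt j hj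
    rcases lt_trichotomy (i : ℕ) j with h | h | h
    · have := lt _ _ h hj2
      rwa [hi1, hj1] at this
    · obtain rfl := Fin.ext h
      rw [swap_self]; exact T.one_mem
    · have := lt _ _ h hi2
      rwa [hi1, hj1, swap_comm] at this
  · intro y hy
    have : y = Fin.last _ := by simpa using hy
    rw [this, hh]

open Equiv in
/-- The idempotent missing the point `i`. -/
def eIdem {Q : Type*} [Monoid Q] {k : ℕ} (ψ : Perm (Fin (k + 3)) →* Q) (b : Q)
    (i : Fin (k + 3)) : Q :=
  ψ (swap i (Fin.last (k + 2))) * b * ψ (swap i (Fin.last (k + 2)))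

section
open Equiv
variable {Q : Type*} [Monoid Q] {k : ℕ} {ψ : Perm (Fin (k + 3)) →* Q} {b : Q}

theorem eIdem_last : eIdem ψ b (Fin.last (k + 2)) = b := by
  simp only [eIdem, swap_self]
  show ψ 1 * b * ψ 1 = b
  simp

theorem Popova.conj (P : Popova k ψ b) (p : Perm (Fin (k + 3))) (i : Fin (k + 3)) :
    ψ p * eIdem ψ b i = eIdem ψ b (p i) * ψ p := by
  set l := Fin.last (k + 2)
  have h := P.stab (swap (p i) l * p * swap i l) (by simp [l])
  have h1 : ψ (swap (p i) l) * ψ (swap (p i) l) = 1 := by rw [← map_mul]; simp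
  have h2 : ψ (swap i l) * ψ (swap i l) = 1 := by rw [← map_mul]; simp
  simp only [map_mul] at h
  show ψ p * (ψ (swap i l) * b * ψ (swap i l)) = ψ (swap (p i) l) * b * ψ (swap (p i) l) * ψ p
  calc _ = (ψ (swap (p i) l) * ψ (swap (p i) l)) * ψ p * (ψ (swap i l) * b * ψ (swap i l)) := by
        rw [h1, one_mul]
    _ = ψ (swap (p i) l) * (ψ (swap (p i) l) * ψ p * ψ (swap i l) * b) * ψ (swap i l) := by
        simp only [mul_assoc]
    _ = _ := by rw [h]; simp only [mul_assoc, h2, mul_one]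

theorem Popova.idem (P : Popova k ψ b) (i : Fin (k + 3)) :
    eIdem ψ b i * eIdem ψ b i = eIdem ψ b i := by
  set l := Fin.last (k + 2)
  have h2 : ψ (swap i l) * ψ (swap i l) = 1 := by rw [← map_mul]; simp
  show ψ (swap i l) * b * ψ (swap i l) * (ψ (swap i l) * b * ψ (swap i l)) = _
  calc _ = ψ (swap i l) * b * (ψ (swap i l) * ψ (swap i l)) * b * ψ (swap i l) := by
        simp only [mul_assoc]
    _ = ψ (swap i l) * (b * b) * ψ (swap i l) := by rw [h2, mul_one]; simp only [mul_assoc]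
    _ = _ := by rw [P.bb]; rfl

theorem Popova.zero (P : Popova k ψ b) :
    ψ (finRotate (k + 3)) * b * ψ (finRotate (k + 3))⁻¹ = eIdem ψ b 0 := by
  have h := P.conj (finRotate (k + 3)) (Fin.last (k + 2))
  rw [eIdem_last, finRotate_last] at h
  rw [h, mul_assoc, ← map_mul]; simp

theorem Popova.base (P : Popova k ψ b) :
    eIdem ψ b 0 * eIdem ψ b 1 = eIdem ψ b 1 * eIdem ψ b 0 ∧
    ψ (swap 0 1) * (eIdem ψ b 0 * eIdem ψ b 1) = eIdem ψ b 0 * eIdem ψ b 1 := by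
  have h1 := P.comm
  have h2 := P.absorb
  rw [P.zero] at h1 h2
  have c0 := P.conj (swap 0 1) 0
  have c1 := P.conj (swap 0 1) 1
  rw [swap_apply_left] at c0
  rw [swap_apply_right] at c1
  have tt : ψ (swap 0 1) * ψ (swap 0 1) = 1 := by rw [← map_mul]; simp
  generalize ψ (swap 0 1) = t at *
  generalize eIdem ψ b 0 = e at *
  generalize eIdem ψ b 1 = f at *
  have l1 : (e * t) ^ 2 = e * f := by
    calc (e * t) ^ 2 = e * (t * e) * t := by rw [pow_two]; simp only [mul_assoc]
      _ = e * f * (t * t) := by rw [c0]; simp only [mul_assoc]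
      _ = _ := by rw [tt, mul_one]
  have l2 : (t * e) ^ 2 = f * e := by
    calc (t * e) ^ 2 = (t * e) * (t * e) := by rw [pow_two]
      _ = (f * t) * (t * e) := by nth_rw 1 [c0]
      _ = f * (t * t) * e := by simp only [mul_assoc]
      _ = _ := by rw [tt, mul_one]
  have l3 : e * t * e = t * (f * e) := by rw [← c1, mul_assoc]
  have hc : e * f = f * e := by rw [← l1, h1, l2]
  refine ⟨hc, ?_⟩
  rw [hc, ← l3, h2, l2]
end

section
open Equiv
variable {Q : Type*} [Monoid Q] {k : ℕ} {ψ : Perm (Fin (k + 3)) →* Q} {b : Q}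

theorem exists_perm_pair {k : ℕ} {i j : Fin (k + 3)} (hij : i ≠ j) :
    ∃ p : Perm (Fin (k + 3)), p 0 = i ∧ p 1 = j := by
  have h01 : (0 : Fin (k + 3)) ≠ 1 := by simp [Fin.ext_iff]
  refine ⟨swap (swap 0 i 1) j * swap 0 i, ?_, ?_⟩
  · rw [Perm.mul_apply, swap_apply_left]
    refine swap_apply_of_ne_of_ne ?_ hij
    intro h
    have : swap (0 : Fin (k + 3)) i 0 = swap 0 i 1 := by rw [swap_apply_left]; exact h
    exact h01 ((swap (0 : Fin (k + 3)) i).injective this)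
  · rw [Perm.mul_apply, swap_apply_left]

theorem Popova.pair (P : Popova k ψ b) {i j : Fin (k + 3)} (hij : i ≠ j) :
    eIdem ψ b i * eIdem ψ b j = eIdem ψ b j * eIdem ψ b i ∧
    ψ (swap i j) * (eIdem ψ b i * eIdem ψ b j) = eIdem ψ b i * eIdem ψ b j := by
  obtain ⟨p, rfl, rfl⟩ := exists_perm_pair hij
  obtain ⟨h1, h2⟩ := P.base
  have pp : ψ p * ψ p⁻¹ = 1 := by rw [← map_mul]; simp
  have e1 : ∀ x y : Fin (k + 3), eIdem ψ b (p x) * eIdem ψ b (p y) =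
      ψ p * (eIdem ψ b x * eIdem ψ b y) * ψ p⁻¹ := by
    intro x y
    rw [← mul_assoc, P.conj p x, mul_assoc (eIdem ψ b (p x)), P.conj p y]
    simp only [mul_assoc, pp, mul_one]
  refine ⟨by rw [e1, e1, h1], ?_⟩
  have h3 : ψ (swap (p 0) (p 1)) * ψ p = ψ p * ψ (swap 0 1) := by
    rw [← map_mul, ← map_mul, Equiv.mul_swap_eq_swap_mul]
  rw [e1]
  calc _ = ψ (swap (p 0) (p 1)) * ψ p * (eIdem ψ b 0 * eIdem ψ b 1) * ψ p⁻¹ := by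
        simp only [mul_assoc]
    _ = ψ p * (ψ (swap 0 1) * (eIdem ψ b 0 * eIdem ψ b 1)) * ψ p⁻¹ := by
        rw [h3]; simp only [mul_assoc]
    _ = _ := by rw [h2]

/-- product of the idempotents of a list -/
def eList (ψ : Perm (Fin (k + 3)) →* Q) (b : Q) (l : List (Fin (k + 3))) : Q :=
  (l.map (eIdem ψ b)).prod

theorem eList_cons (i : Fin (k + 3)) (l : List (Fin (k + 3))) :
    eList ψ b (i :: l) = eIdem ψ b i * eList ψ b l := by simp [eList]

theorem Popova.comm' (P : Popova k ψ b) (i j : Fin (k + 3)) :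
    Commute (eIdem ψ b i) (eIdem ψ b j) := by
  by_cases h : i = j
  · subst h; exact Commute.refl _
  · exact (P.pair h).1

theorem Popova.comm_list (P : Popova k ψ b) (i : Fin (k + 3)) (l : List (Fin (k + 3))) :
    Commute (eIdem ψ b i) (eList ψ b l) := by
  induction l with
  | nil => exact Commute.one_right _
  | cons j l ih => rw [eList_cons]; exact (P.comm' i j).mul_right ih

theorem Popova.comm_lists (P : Popova k ψ b) (l l' : List (Fin (k + 3))) :
    Commute (eList ψ b l) (eList ψ b l') := by
  induction l with
  | nil => exact Commute.one_left _
  | cons j l ih => rw [eList_cons]; exact (P.comm_list j l').mul_left ih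

theorem Popova.mem_absorb (P : Popova k ψ b) (i : Fin (k + 3)) (l : List (Fin (k + 3)))
    (hi : i ∈ l) : eIdem ψ b i * eList ψ b l = eList ψ b l := by
  induction l with
  | nil => simp at hi
  | cons j l ih =>
    rw [eList_cons]
    rcases List.mem_cons.1 hi with h | h
    · subst h; rw [← mul_assoc, P.idem]
    · rw [← mul_assoc, (P.comm' i j).eq, mul_assoc, ih h]

theorem Popova.sub_absorb (P : Popova k ψ b) (l l' : List (Fin (k + 3)))
    (h : ∀ i ∈ l, i ∈ l') : eList ψ b l * eList ψ b l' = eList ψ b l' := by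
  induction l with
  | nil => simp [eList]
  | cons j l ih =>
    rw [eList_cons, mul_assoc, ih (fun i hi => h i (by simp [hi])), P.mem_absorb _ _ (h j (by simp))]

theorem Popova.list_eq (P : Popova k ψ b) (l l' : List (Fin (k + 3)))
    (h : ∀ i, i ∈ l ↔ i ∈ l') : eList ψ b l = eList ψ b l' := by
  rw [← P.sub_absorb l l' fun i => (h i).1, (P.comm_lists l l').eq,
    P.sub_absorb l' l fun i => (h i).2]

theorem Popova.fix (P : Popova k ψ b) (l : List (Fin (k + 3))) (p : Perm (Fin (k + 3)))
    (hp : ∀ y, y ∉ l → p y = y) : ψ p * eList ψ b l = eList ψ b l := by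
  let T : Submonoid (Perm (Fin (k + 3))) :=
    { carrier := {p | ψ p * eList ψ b l = eList ψ b l}
      one_mem' := by simp
      mul_mem' := by
        intro p q hp hq
        simp only [Set.mem_ofPred_eq, map_mul] at *
        rw [mul_assoc, hq, hp] }
  refine perm_mem_of_swaps T l.toFinset ?_ p ?_
  · intro i hi j hj
    by_cases hij : i = j
    · subst hij; rw [swap_self]; exact T.one_mem
    · show ψ (swap i j) * eList ψ b l = eList ψ b l
      have e : eList ψ b l = eIdem ψ b i * eIdem ψ b j * eList ψ b l := by
        rw [mul_assoc, P.mem_absorb j l (by simpa using hj), P.mem_absorb i l (by simpa using hi)]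
      rw [e, ← mul_assoc, (P.pair hij).2]
  · intro y hy; exact hp y (by simpa using hy)

/-- normal form partial map -/
def nfMap (k : ℕ) (p : Perm (Fin (k + 3))) (l : List (Fin (k + 3))) (ε : Bool) :
    Fin (k + 4) →. Fin (k + 4) :=
  fun x => Fin.cases (motive := fun _ => Part (Fin (k + 4)))
    (if ε then Part.none else Part.some 0)
    (fun i => if p⁻¹ i ∈ l then Part.none else Part.some (p⁻¹ i).succ) x

theorem nfMap_zero (p : Perm (Fin (k + 3))) (l : List (Fin (k + 3))) (ε : Bool) :
    nfMap k p l ε 0 = if ε then Part.none else Part.some 0 := rfl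

theorem nfMap_succ (p : Perm (Fin (k + 3))) (l : List (Fin (k + 3))) (ε : Bool) (i : Fin (k + 3)) :
    nfMap k p l ε i.succ = if p⁻¹ i ∈ l then Part.none else Part.some (p⁻¹ i).succ := rfl

theorem nfMap_inj {p p' : Perm (Fin (k + 3))} {l l' : List (Fin (k + 3))} {ε ε' : Bool}
    (h : nfMap k p l ε = nfMap k p' l' ε') :
    ε = ε' ∧ (∀ i, i ∈ l ↔ i ∈ l') ∧ ∀ y, y ∉ l → (p'⁻¹ * p) y = y := by
  have mem : ∀ (p : Perm (Fin (k + 3))) (l : List (Fin (k + 3))) ε i,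
      i ∉ l ↔ ∃ j : Fin (k + 3), i.succ ∈ nfMap k p l ε j.succ := by
    intro p l ε i
    constructor
    · intro hi
      refine ⟨p i, ?_⟩
      rw [nfMap_succ]
      simp [hi]
    · rintro ⟨j, hj⟩
      rw [nfMap_succ] at hj
      split_ifs at hj with h1
      · simp at hj
      · simp only [Part.mem_some_iff, Fin.succ_inj] at hj
        rwa [hj]
  refine ⟨?_, ?_, ?_⟩
  · have h0 := congrFun h 0
    rw [nfMap_zero, nfMap_zero] at h0
    cases ε <;> cases ε' <;> simp_all
  · intro i
    have := mem p l ε i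
    rw [h, ← mem] at this
    exact not_iff_not.1 this
  · intro y hy
    have h0 := congrFun h (p y).succ
    rw [nfMap_succ, nfMap_succ] at h0
    have hpy : p⁻¹ (p y) = y := by simp
    rw [hpy, if_neg hy] at h0
    split_ifs at h0 with h1
    · simp at h0
    · simp only [Part.some_inj, Fin.succ_inj] at h0
      exact h0.symm

theorem mul_pfun_some {V : Type*} {f : V →. V} (g : V →. V) {x y : V} (h : f x = Part.some y) :
    (f * g) x = g y := by
  have e : (f * g) x = (f x).bind (fun z => g z) := rfl
  rw [e, h, Part.bind_some]

theorem mul_pfun_none {V : Type*} {f : V →. V} (g : V →. V) {x : V} (h : f x = Part.none) :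
    (f * g) x = Part.none := by
  have e : (f * g) x = (f x).bind (fun z => g z) := rfl
  rw [e, h, Part.bind_none]

theorem alphaOne_zero : alphaOne (k + 4) (by omega) 0 = Part.some 0 := by simp [alphaOne]

theorem alphaOne_succ (i : Fin (k + 3)) :
    alphaOne (k + 4) (by omega) i.succ = Part.some (finRotate (k + 3) i).succ := by
  simp only [alphaOne]
  congr 1
  by_cases h : i = Fin.last (k + 2)
  · subst h
    rw [finRotate_last]
    simp [Fin.ext_iff]
  · have h1 := coe_finRotate_of_ne_last h
    have h2 : (i : ℕ) ≠ k + 2 := fun h' => h (Fin.ext h')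
    ext
    have h3 : ((finRotate (k + 3) i).succ : ℕ) = i + 1 + 1 := by rw [Fin.val_succ, h1]
    rw [h3]
    simp [h2]

theorem alphaTwo_zero : alphaTwo (k + 4) (by omega) 0 = Part.some 0 := by simp [alphaTwo]

theorem alphaTwo_succ (i : Fin (k + 3)) :
    alphaTwo (k + 4) (by omega) i.succ = Part.some (swap 0 1 i).succ := by
  simp only [alphaTwo]
  congr 1
  rw [swap_apply_def]
  ext
  simp only [Fin.val_succ, apply_ite Fin.val, Fin.ext_iff, Fin.val_zero, Fin.val_one]
  split_ifs <;> omega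

theorem betaOne_zero : betaOne (k + 4) 0 = Part.some 0 := by simp [betaOne]

theorem betaOne_succ (i : Fin (k + 3)) :
    betaOne (k + 4) i.succ = if i = Fin.last (k + 2) then Part.none else Part.some i.succ := by
  simp only [betaOne, Fin.val_succ, Fin.ext_iff, Fin.val_last]
  have := i.isLt
  split_ifs <;> first | rfl | omega

theorem betaTwo_zero : betaTwo (k + 4) 0 = Part.none := by simp [betaTwo]

theorem betaTwo_succ (i : Fin (k + 3)) : betaTwo (k + 4) i.succ = Part.some i.succ := by
  simp [betaTwo]

theorem normal_form (P : Popova k ψ b) (d : Q) (dd : d * d = d)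
    (da : d * ψ (finRotate (k + 3))⁻¹ = ψ (finRotate (k + 3))⁻¹ * d)
    (dt : d * ψ (swap 0 1) = ψ (swap 0 1) * d) (db : d * b = b * d)
    (π : W →* Q) (h1 : π wa1 = ψ (finRotate (k + 3))⁻¹) (h2 : π wa2 = ψ (swap 0 1))
    (h3 : π wb1 = b) (h4 : π wb2 = d) (w : W) :
    cnt Gen.c w = 0 → ∃ p l ε, π w = (if ε = true then d else 1) * (ψ p * eList ψ b l) ∧
      phi (k + 4) (by omega) w = nfMap k p l ε := by
  induction w using FreeMonoid.inductionOn' with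
  | one =>
    intro _
    refine ⟨1, [], false, by simp [eList], ?_⟩
    rw [map_one]
    funext x
    show Part.some x = _
    refine Fin.cases ?_ (fun i => ?_) x
    · simp [nfMap_zero]
    · simp [nfMap_succ]
  | of_mul g w ih =>
    intro hc
    have hgc : g ≠ Gen.c ∧ cnt Gen.c w = 0 := by
      have : cnt Gen.c (FreeMonoid.of g * w) = (g :: FreeMonoid.toList w).count Gen.c := rfl
      rw [this, List.count_cons] at hc
      refine ⟨?_, ?_⟩
      · rintro rfl; simp at hc
      · show (FreeMonoid.toList w).count Gen.c = 0
        omega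
    obtain ⟨p, l, ε, hπ, hφ⟩ := ih hgc.2
    have hphi : phi (k + 4) (by omega) (FreeMonoid.of g * w) =
        genMap (k + 4) (by omega) g * nfMap k p l ε := by
      rw [map_mul, hφ]; simp [phi]
    rw [hphi, map_mul, hπ]
    have dε : ∀ z : Q, d * z = z * d →
        z * ((if ε = true then d else 1) * (ψ p * eList ψ b l)) =
        (if ε = true then d else 1) * (z * ψ p * eList ψ b l) := by
      intro z hz
      cases ε
      · simp [mul_assoc]
      · simp only [if_true]
        rw [← mul_assoc, ← hz]; simp only [mul_assoc]
    cases g with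
    | a1 =>
      refine ⟨(finRotate (k + 3))⁻¹ * p, l, ε, ?_, ?_⟩
      · show π wa1 * _ = _
        rw [h1, dε _ da, map_mul]
      · funext x
        refine Fin.cases ?_ (fun i => ?_) x
        · simp only [genMap]; rw [mul_pfun_some _ alphaOne_zero]; rfl
        · simp only [genMap]; rw [mul_pfun_some _ (alphaOne_succ i), nfMap_succ, nfMap_succ]
          simp only [mul_inv_rev, inv_inv, Perm.mul_apply]
    | a2 =>
      refine ⟨swap 0 1 * p, l, ε, ?_, ?_⟩
      · show π wa2 * _ = _
        rw [h2, dε _ dt, map_mul]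
      · funext x
        refine Fin.cases ?_ (fun i => ?_) x
        · simp only [genMap]; rw [mul_pfun_some _ alphaTwo_zero]; rfl
        · simp only [genMap]; rw [mul_pfun_some _ (alphaTwo_succ i), nfMap_succ, nfMap_succ]
          simp only [mul_inv_rev, swap_inv, Perm.mul_apply]
    | b1 =>
      refine ⟨p, p⁻¹ (Fin.last (k + 2)) :: l, ε, ?_, ?_⟩
      · show π wb1 * _ = _
        have := P.conj p (p⁻¹ (Fin.last (k + 2)))
        have hpl : p (p⁻¹ (Fin.last (k + 2))) = Fin.last (k + 2) := by simp
        rw [hpl, eIdem_last] at this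
        rw [h3, dε _ db, eList_cons, ← mul_assoc (ψ p), this]
      · funext x
        refine Fin.cases ?_ (fun i => ?_) x
        · simp only [genMap]; rw [mul_pfun_some _ betaOne_zero]; rfl
        · simp only [genMap]
          have hb := betaOne_succ i
          rw [nfMap_succ]
          simp only [List.mem_cons, (p⁻¹).injective.eq_iff]
          by_cases h : i = Fin.last (k + 2)
          · rw [if_pos h] at hb
            rw [mul_pfun_none _ hb, if_pos (Or.inl h)]
          · rw [if_neg h] at hb
            rw [mul_pfun_some _ hb, nfMap_succ]
            simp only [h, false_or]
    | b2 =>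
      refine ⟨p, l, true, ?_, ?_⟩
      · show π wb2 * _ = _
        rw [h4]
        cases ε
        · simp
        · simp only [if_true]; rw [← mul_assoc, dd]
      · funext x
        refine Fin.cases ?_ (fun i => ?_) x
        · simp only [genMap]; rw [mul_pfun_none _ betaTwo_zero]; rfl
        · simp only [genMap]; rw [mul_pfun_some _ (betaTwo_succ i)]; rfl
    | c => exact absurd rfl hgc.1

end

open Equiv in
theorem statement16 (n : ℕ) (hn : 4 ≤ n) (w1 w2 : W)
    (h1 : cnt Gen.c w1 = 0) (h2 : cnt Gen.c w2 = 0)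
    (h : phi n (by omega) w1 = phi n (by omega) w2) :
    conGen (Rrel n) w1 w2 := by
  obtain ⟨k, rfl⟩ : ∃ k, n = k + 4 := ⟨n - 4, by omega⟩
  let π : W →* (conGen (Rrel (k + 4))).Quotient := (conGen (Rrel (k + 4))).mk'
  have rel : ∀ u v, Rrel (k + 4) u v → π u = π v := fun u v huv =>
    (Con.eq _).2 (ConGen.Rel.of _ _ huv)
  have r1 := rel (wa2 ^ 2) 1 (by simp [Rrel])
  have r2 := rel (wa1 ^ (k + 3)) 1 (by simp [Rrel])
  have r3 := rel ((wa1 * wa2) ^ (k + 2)) 1 (by simp [Rrel])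
  have r4 := rel ((wa2 * wa1 ^ (k + 2) * wa2 * wa1) ^ 3) 1 (by simp [Rrel])
  have r5 : ∀ j, 2 ≤ j → j ≤ k + 1 →
      π ((wa2 * wa1 ^ (k + 3 - j) * wa2 * wa1 ^ j) ^ 2) = π 1 := fun j hj1 hj2 =>
    rel _ _ (by unfold Rrel; exact Or.inr <| Or.inr <| Or.inr <| Or.inr <| Or.inl ⟨j, hj1, hj2, rfl, rfl⟩)
  have r6 := rel (wb1 ^ 2) wb1 (by simp [Rrel])
  have r7 := rel (wb2 ^ 2) wb2 (by simp [Rrel])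
  have r8 := rel (wa2 * wb1) (wb1 * wa2) (by simp [Rrel])
  have r9 := rel (wb2 * wa2) (wa2 * wb2) (by simp [Rrel])
  have r10 := rel (wb2 * wa1) (wa1 * wb2) (by simp [Rrel])
  have r11 := rel (wb2 * wb1) (wb1 * wb2) (by simp [Rrel])
  have r12 := rel (wa1 * wa2 * wa1 ^ (k + 2) * wb1 * wa1 * wa2 * wa1 ^ (k + 2))
    (wa1 ^ (k + 2) * wb1 * wa1) (by simp [Rrel])
  have r13 := rel ((wa1 ^ (k + 2) * wb1 * wa1 * wa2) ^ 2) ((wa2 * wa1 ^ (k + 2) * wb1 * wa1) ^ 2)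
    (by simp [Rrel])
  have r14 := rel (wa1 ^ (k + 2) * wb1 * wa1 * wa2 * wa1 ^ (k + 2) * wb1 * wa1)
    ((wa2 * wa1 ^ (k + 2) * wb1 * wa1) ^ 2) (by simp [Rrel])
  suffices hs : π w1 = π w2 from (Con.eq _).1 hs
  simp only [map_mul, map_pow, map_one] at r1 r2 r3 r4 r5 r6 r7 r8 r9 r10 r11 r12 r13 r14
  clear rel
  clear_value π
  let ua : ((conGen (Rrel (k + 4))).Quotient)ˣ := 
    ⟨π wa1, π wa1 ^ (k + 2), by rw [← pow_succ', r2], by rw [← pow_succ, r2]⟩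
  let ut : ((conGen (Rrel (k + 4))).Quotient)ˣ := 
    ⟨π wa2, π wa2, by rw [← pow_two, r1], by rw [← pow_two, r1]⟩
  have va : (ua : (conGen (Rrel (k + 4))).Quotient) = π wa1 := rfl
  have vai : ((ua⁻¹ : ((conGen (Rrel (k + 4))).Quotient)ˣ) : (conGen (Rrel (k + 4))).Quotient)
    = π wa1 ^ (k + 2) := rfl
  have vt : (ut : (conGen (Rrel (k + 4))).Quotient) = π wa2 := rfl
  have ha : ua ^ (k + 3) = 1 := Units.ext (by rw [Units.val_pow_eq_pow_val, va, r2]; rfl)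
  obtain ⟨ψ0, hψa, hψt⟩ := moore_hom k ua ut
    (Units.ext (by rw [Units.val_mul, vt, ← pow_two, r1]; rfl)) ha
    (Units.ext (by rw [Units.val_pow_eq_pow_val, Units.val_mul, va, vt, r3]; rfl))
    (Units.ext (by
      simp only [Units.val_pow_eq_pow_val, Units.val_mul, va, vt, vai, r4]; rfl))
    (by
      intro j hj1 hj2
      have e : (ua ^ j)⁻¹ = ua ^ (k + 3 - j) := by
        rw [inv_eq_iff_mul_eq_one, ← pow_add, Nat.add_sub_cancel' (by omega), ha]
      rw [e]
      refine Units.ext ?_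
      simp only [Units.val_pow_eq_pow_val, Units.val_mul, va, vt, r5 j hj1 hj2]; rfl)
  let ψ := (Units.coeHom _).comp ψ0
  have e1 : ψ (finRotate (k + 3))⁻¹ = π wa1 := by
    show (ψ0 (finRotate (k + 3))⁻¹ : (conGen (Rrel (k + 4))).Quotient) = _
    rw [hψa]
  have e2 : ψ (finRotate (k + 3)) = π wa1 ^ (k + 2) := by
    show (ψ0 (finRotate (k + 3)) : (conGen (Rrel (k + 4))).Quotient) = _
    rw [← vai, ← hψa, map_inv, inv_inv]
  have e3 : ψ (swap 0 1) = π wa2 := by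
    show (ψ0 (swap 0 1) : (conGen (Rrel (k + 4))).Quotient) = _
    rw [hψt]
  have P : Popova k ψ (π wb1) := by
    constructor
    · rw [← pow_two, r6]
    · rw [e3, r8]
    · rw [e1, e2, e3, r12]
    · rw [e1, e2, e3, r13]; simp only [mul_assoc]
    · rw [e1, e2, e3]; simp only [mul_assoc] at r14 ⊢; exact r14
  have nf := normal_form P (π wb2) (by rw [← pow_two, r7]) (by rw [e1, r10]) (by rw [e3, r9]) r11
    π e1.symm e3.symm rfl rfl
  obtain ⟨p, l, ε, hπ, hφ⟩ := nf w1 h1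
  obtain ⟨p', l', ε', hπ', hφ'⟩ := nf w2 h2
  rw [hφ, hφ'] at h
  obtain ⟨rfl, hl, hp⟩ := nfMap_inj h
  have hfix := P.fix l _ hp
  rw [hπ, hπ', ← P.list_eq l l' hl]
  congr 1
  have : p = p' * (p'⁻¹ * p) := by rw [mul_inv_cancel_left]
  rw [this, map_mul, mul_assoc, hfix]

end DPSPaper
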